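/- arXiv:2503.08832 — 3 statements merged into one kernel-verified Lean document; each statement's English description precedes it below -/
import Mathlib

section
/- Let (V, ⊗, I) be a monoidal category with projections. Then the identity functor of V underlies a lax monoidal functor from the cartesian monoidal structure (V, ×, terminal object) to (V, ⊗, I): its unit constraint is the unique morphism from I to the terminal object (an isomorphism, since I is terminal), and its structure morphisms are π = (π₁, π₂) : X ⊗ Y → X × Y; these data satisfy the associativity and unitality coherence axioms of a lax monoidal functor. Similarly, the identity functor underlies a lax monoidal functor from (V, ×) to the reversed monoidal category (V, ⊗̄, I), with structure morphisms the maps X ⊗̄ Y = Y ⊗ X → X × Y with components π₂ and π₁. -/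
universe v u w w'

open CategoryTheory MonoidalCategory Limits

noncomputable section

namespace PaperComma

variable {V : Type u} [Category.{v} V] [MonoidalCategory V]

/-- A *right closed* structure on a monoidal category `V`: for every object `Y`, the
functor `- ⊗ Y` admits a right adjoint `Homᵣ(Y, -)`. -/
structure RightClosed (V : Type u) [Category.{v} V] [MonoidalCategory V] where
  homr : V → V ⥤ V
  adj : ∀ Y : V, tensorRight Y ⊣ homr Y

/-- A *left closed* structure on a monoidal category `V`: for every object `X`, the
functor `X ⊗ -` admits a right adjoint `Homₗ(X, -)`. -/
structure LeftClosed (V : Type u) [Category.{v} V] [MonoidalCategory V] where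
  homl : V → V ⥤ V
  adj : ∀ X : V, tensorLeft X ⊣ homl X

namespace RightClosed

variable (R : RightClosed V)

/-- `Homᵣ(Y, Z)`. -/
def hr (Y Z : V) : V := (R.homr Y).obj Z

/-- Transposition under the adjunction `- ⊗ Y ⊣ Homᵣ(Y, -)`. -/
def curry {X Y Z : V} (f : X ⊗ Y ⟶ Z) : X ⟶ R.hr Y Z :=
  ((R.adj Y).homEquiv X Z) f

/-- Inverse transposition. -/
def uncurry {X Y Z : V} (g : X ⟶ R.hr Y Z) : X ⊗ Y ⟶ Z :=
  ((R.adj Y).homEquiv X Z).symm g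

/-- The evaluation morphism (counit) `Homᵣ(Y, Z) ⊗ Y ⟶ Z`. -/
def ev (Y Z : V) : R.hr Y Z ⊗ Y ⟶ Z :=
  (R.adj Y).counit.app Z

/-- The identity `I ⟶ Homᵣ(X, X)` of the `V`-category `V_r`. -/
def idr (X : V) : 𝟙_ V ⟶ R.hr X X :=
  R.curry (λ_ X).hom

/-- The composition `Homᵣ(Y, Z) ⊗ Homᵣ(X, Y) ⟶ Homᵣ(X, Z)` of the `V`-category `V_r`. -/
def compr (X Y Z : V) : R.hr Y Z ⊗ R.hr X Y ⟶ R.hr X Z :=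
  R.curry ((α_ (R.hr Y Z) (R.hr X Y) X).hom ≫ (R.hr Y Z ◁ R.ev X Y) ≫ R.ev Y Z)

/-- Contravariant action of `Homᵣ` in its first variable. -/
def pre {Y' Y : V} (f : Y' ⟶ Y) (Z : V) : R.hr Y Z ⟶ R.hr Y' Z :=
  R.curry ((R.hr Y Z ◁ f) ≫ R.ev Y Z)

end RightClosed

namespace LeftClosed

variable (L : LeftClosed V)

/-- `Homₗ(X, Z)`. -/
def hl (X Z : V) : V := (L.homl X).obj Z

/-- Transposition under the adjunction `X ⊗ - ⊣ Homₗ(X, -)`. -/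
def curry {X A B : V} (f : X ⊗ A ⟶ B) : A ⟶ L.hl X B :=
  ((L.adj X).homEquiv A B) f

/-- Inverse transposition. -/
def uncurry {X A B : V} (g : A ⟶ L.hl X B) : X ⊗ A ⟶ B :=
  ((L.adj X).homEquiv A B).symm g

/-- The evaluation morphism (counit) `X ⊗ Homₗ(X, Z) ⟶ Z`. -/
def ev (X Z : V) : X ⊗ L.hl X Z ⟶ Z :=
  (L.adj X).counit.app Z

/-- The identity `I ⟶ Homₗ(X, X)` of the anti `V`-category `V_l`. -/
def idl (X : V) : 𝟙_ V ⟶ L.hl X X :=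
  L.curry (ρ_ X).hom

/-- The composition `Homₗ(X, Y) ⊗ Homₗ(Y, Z) ⟶ Homₗ(X, Z)` of the anti `V`-category `V_l`. -/
def compl (X Y Z : V) : L.hl X Y ⊗ L.hl Y Z ⟶ L.hl X Z :=
  L.curry ((α_ X (L.hl X Y) (L.hl Y Z)).inv ≫ (L.ev X Y ▷ L.hl Y Z) ≫ L.ev Y Z)

/-- Contravariant action of `Homₗ` in its first variable. -/
def pre {X' X : V} (g : X' ⟶ X) (Z : V) : L.hl X Z ⟶ L.hl X' Z :=
  L.curry ((g ▷ L.hl X Z) ≫ L.ev X Z)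

end LeftClosed

section Projections

variable (hI : IsTerminal (𝟙_ V))

/-- The first projection `X ⊗ Y ⟶ X`, when the monoidal unit is terminal. -/
def pi1 (X Y : V) : X ⊗ Y ⟶ X := (X ◁ hI.from Y) ≫ (ρ_ X).hom

/-- The second projection `X ⊗ Y ⟶ Y`, when the monoidal unit is terminal. -/
def pi2 (X Y : V) : X ⊗ Y ⟶ Y := (hI.from X ▷ Y) ≫ (λ_ Y).hom

/-- The canonical morphism `π = (π₁, π₂) : X ⊗ Y ⟶ X ⨯ Y`. -/
def piMap [HasBinaryProducts V] (X Y : V) : X ⊗ Y ⟶ X ⨯ Y :=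
  prod.lift (pi1 hI X Y) (pi2 hI X Y)

end Projections

end PaperComma


namespace PaperComma

variable {V : Type u} [Category.{v} V] [MonoidalCategory V]

/-- The structure morphism of the lax monoidal identity functor `(V, ×) → (V, ⊗̄)`:
`X ⊗̄ Y = Y ⊗ X ⟶ X ⨯ Y` with components `π₂` and `π₁`. -/
def piMapRev [HasFiniteProducts V] (hI : IsTerminal (𝟙_ V)) (X Y : V) : Y ⊗ X ⟶ X ⨯ Y :=
  prod.lift (pi2 hI Y X) (pi1 hI Y X)

section Helpers

variable (hI : IsTerminal (𝟙_ V))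

lemma wr_pi1 {X X' : V} (f : X ⟶ X') (Y : V) :
    (f ▷ Y) ≫ pi1 hI X' Y = pi1 hI X Y ≫ f := by
  simp only [pi1, Category.assoc, ← rightUnitor_naturality, whisker_exchange_assoc]

lemma wl_pi1 (X : V) {Y Y' : V} (g : Y ⟶ Y') :
    (X ◁ g) ≫ pi1 hI X Y' = pi1 hI X Y := by
  have : g ≫ hI.from Y' = hI.from Y := hI.hom_ext _ _
  rw [pi1, pi1, ← whiskerLeft_comp_assoc, this]

lemma wl_pi2 (X : V) {Y Y' : V} (g : Y ⟶ Y') :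
    (X ◁ g) ≫ pi2 hI X Y' = pi2 hI X Y ≫ g := by
  simp only [pi2, Category.assoc, ← leftUnitor_naturality, whisker_exchange_assoc]

lemma wr_pi2 {X X' : V} (f : X ⟶ X') (Y : V) :
    (f ▷ Y) ≫ pi2 hI X' Y = pi2 hI X Y := by
  have : f ≫ hI.from X' = hI.from X := hI.hom_ext _ _
  rw [pi2, pi2, ← comp_whiskerRight_assoc, this]

lemma assoc_pi1 (X Y Z : V) :
    (α_ X Y Z).hom ≫ (X ◁ pi1 hI Y Z) = pi1 hI (X ⊗ Y) Z := by
  simp [pi1]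

lemma assoc_pi2 (X Y Z : V) :
    (α_ X Y Z).hom ≫ pi2 hI X (Y ⊗ Z) = pi2 hI X Y ▷ Z := by
  simp [pi2]

lemma assoc_pi1' (X Y Z : V) :
    (α_ X Y Z).hom ≫ pi1 hI X (Y ⊗ Z) = pi1 hI (X ⊗ Y) Z ≫ pi1 hI X Y := by
  rw [← wl_pi1 hI X (pi1 hI Y Z), ← Category.assoc, assoc_pi1]

lemma assoc_pi2_1 (X Y Z : V) :
    (α_ X Y Z).hom ≫ pi2 hI X (Y ⊗ Z) ≫ pi1 hI Y Z = pi1 hI (X ⊗ Y) Z ≫ pi2 hI X Y := by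
  rw [← Category.assoc, assoc_pi2, wr_pi1]

lemma assoc_pi2_2 (X Y Z : V) :
    (α_ X Y Z).hom ≫ pi2 hI X (Y ⊗ Z) ≫ pi2 hI Y Z = pi2 hI (X ⊗ Y) Z := by
  rw [← Category.assoc, assoc_pi2, wr_pi2]

lemma pi2_unit (X : V) : pi2 hI (𝟙_ V) X = (λ_ X).hom := by
  have : hI.from (𝟙_ V) = 𝟙 _ := hI.hom_ext _ _
  simp [pi2, this]

lemma pi1_unit (X : V) : pi1 hI X (𝟙_ V) = (ρ_ X).hom := by
  have : hI.from (𝟙_ V) = 𝟙 _ := hI.hom_ext _ _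
  simp [pi1, this]

variable [HasFiniteProducts V]

lemma piMap_fst (X Y : V) : piMap hI X Y ≫ prod.fst = pi1 hI X Y := prod.lift_fst _ _
lemma piMap_snd (X Y : V) : piMap hI X Y ≫ prod.snd = pi2 hI X Y := prod.lift_snd _ _
lemma piMapRev_fst (X Y : V) : piMapRev hI X Y ≫ prod.fst = pi2 hI Y X := prod.lift_fst _ _
lemma piMapRev_snd (X Y : V) : piMapRev hI X Y ≫ prod.snd = pi1 hI Y X := prod.lift_snd _ _

lemma hom_ext3 {W X Y Z : V} {f g : W ⟶ X ⨯ (Y ⨯ Z)} (h1 : f ≫ prod.fst = g ≫ prod.fst)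
    (h2 : f ≫ prod.snd ≫ prod.fst = g ≫ prod.snd ≫ prod.fst)
    (h3 : f ≫ prod.snd ≫ prod.snd = g ≫ prod.snd ≫ prod.snd) : f = g := by
  apply Limits.prod.hom_ext h1
  apply Limits.prod.hom_ext <;> simpa using by assumption

lemma asc_1 (X Y Z : V) : (prod.associator X Y Z).hom ≫ prod.fst = prod.fst ≫ prod.fst :=
  prod.lift_fst _ _
lemma asc_2 (X Y Z : V) : (prod.associator X Y Z).hom ≫ prod.snd ≫ prod.fst
    = prod.fst ≫ prod.snd :=
  (Limits.prod.lift_snd_assoc _ _ _).trans (prod.lift_fst _ _)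
lemma asc_3 (X Y Z : V) : (prod.associator X Y Z).hom ≫ prod.snd ≫ prod.snd
    = prod.snd :=
  (Limits.prod.lift_snd_assoc _ _ _).trans (prod.lift_snd _ _)

end Helpers

/-- Let `(V, ⊗, I)` be a monoidal category with projections (finite
products, and the unit `I` terminal). Then the identity functor of `V` underlies a lax
monoidal functor from the cartesian monoidal structure `(V, ×, ⊤)` to `(V, ⊗, I)`: its
unit constraint is the unique morphism `I ⟶ ⊤` (an isomorphism, since `I` is terminal),
its structure morphisms are `π = (π₁, π₂) : X ⊗ Y ⟶ X ⨯ Y`, and these data satisfy the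
associativity and unitality coherence axioms of a lax monoidal functor. Similarly the
identity functor underlies a lax monoidal functor from `(V, ×)` to the reversed monoidal
category `(V, ⊗̄, I)`, with structure morphisms `Y ⊗ X = X ⊗̄ Y ⟶ X ⨯ Y` with
components `π₂` and `π₁`. -/
theorem identity_laxMonoidal_of_projections
    [HasFiniteProducts V] (hI : IsTerminal (𝟙_ V)) :
    -- the unit constraint is an isomorphism
    IsIso (terminal.from (𝟙_ V)) ∧
    -- associativity coherence for `(V, ×) → (V, ⊗)`
    (∀ X Y Z : V,
      (piMap hI X Y ▷ Z) ≫ piMap hI (X ⨯ Y) Z ≫ (prod.associator X Y Z).hom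
        = (α_ X Y Z).hom ≫ (X ◁ piMap hI Y Z) ≫ piMap hI X (Y ⨯ Z)) ∧
    -- left unitality coherence for `(V, ×) → (V, ⊗)`
    (∀ X : V,
      (λ_ X).hom
        = (terminal.from (𝟙_ V) ▷ X) ≫ piMap hI (⊤_ V) X ≫ (prod.leftUnitor X).hom) ∧
    -- right unitality coherence for `(V, ×) → (V, ⊗)`
    (∀ X : V,
      (ρ_ X).hom
        = (X ◁ terminal.from (𝟙_ V)) ≫ piMap hI X (⊤_ V) ≫ (prod.rightUnitor X).hom) ∧
    -- associativity coherence for `(V, ×) → (V, ⊗̄)`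
    (∀ X Y Z : V,
      (Z ◁ piMapRev hI X Y) ≫ piMapRev hI (X ⨯ Y) Z ≫ (prod.associator X Y Z).hom
        = (α_ Z Y X).inv ≫ (piMapRev hI Y Z ▷ X) ≫ piMapRev hI X (Y ⨯ Z)) ∧
    -- left unitality coherence for `(V, ×) → (V, ⊗̄)`
    (∀ X : V,
      (ρ_ X).hom
        = (X ◁ terminal.from (𝟙_ V)) ≫ piMapRev hI (⊤_ V) X ≫ (prod.leftUnitor X).hom) ∧
    -- right unitality coherence for `(V, ×) → (V, ⊗̄)`
    (∀ X : V,
      (λ_ X).hom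
        = (terminal.from (𝟙_ V) ▷ X) ≫ piMapRev hI X (⊤_ V) ≫ (prod.rightUnitor X).hom) := by
  have e1 := fun X Y => piMap_fst hI X Y
  have e2 := fun X Y => piMap_snd hI X Y
  have r1 := fun X Y => piMapRev_fst hI X Y
  have r2 := fun X Y => piMapRev_snd hI X Y
  have e1a := fun X Y {W : V} (k : _ ⟶ W) => (reassoc_of% (piMap_fst hI X Y)) k
  have e2a := fun X Y {W : V} (k : _ ⟶ W) => (reassoc_of% (piMap_snd hI X Y)) k
  have r1a := fun X Y {W : V} (k : _ ⟶ W) => (reassoc_of% (piMapRev_fst hI X Y)) k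
  have r2a := fun X Y {W : V} (k : _ ⟶ W) => (reassoc_of% (piMapRev_snd hI X Y)) k
  have w1 := fun {X X' : V} (f : X ⟶ X') (Y : V) {W : V} (k : _ ⟶ W) =>
    (reassoc_of% (wr_pi1 hI f Y)) k
  have w2 := fun {X X' : V} (f : X ⟶ X') (Y : V) {W : V} (k : _ ⟶ W) =>
    (reassoc_of% (wr_pi2 hI f Y)) k
  have w3 := fun (Y : V) {X X' : V} (f : X ⟶ X') {W : V} (k : _ ⟶ W) =>
    (reassoc_of% (wl_pi1 hI Y f)) k
  have w4 := fun (Y : V) {X X' : V} (f : X ⟶ X') {W : V} (k : _ ⟶ W) =>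
    (reassoc_of% (wl_pi2 hI Y f)) k
  refine ⟨?_, ?_, ?_, ?_, ?_, ?_, ?_⟩
  · exact ⟨hI.from _, hI.hom_ext _ _, terminalIsTerminal.hom_ext _ _⟩
  · intro X Y Z
    apply hom_ext3 <;>
    simp only [Category.assoc, asc_1, asc_2, asc_3, e1, e2, e1a, e2a, w1, w2, w3, w4,
      wr_pi1, wr_pi2, wl_pi1, wl_pi2, assoc_pi1', assoc_pi2_1, assoc_pi2_2]
  · intro X
    simp only [prod.leftUnitor_hom, e2, wr_pi2, pi2_unit]
  · intro X
    simp only [prod.rightUnitor_hom, e1, wl_pi1, pi1_unit]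
  · intro X Y Z
    rw [Iso.eq_inv_comp]
    apply hom_ext3 <;>
    simp only [Category.assoc, asc_1, asc_2, asc_3, r1, r2, r1a, r2a, w1, w2, w3, w4,
      wr_pi1, wr_pi2, wl_pi1, wl_pi2, assoc_pi1', assoc_pi2_1, assoc_pi2_2]
  · intro X
    simp only [prod.leftUnitor_hom, r2, wl_pi1, pi1_unit]
  · intro X
    simp only [prod.rightUnitor_hom, r1, wr_pi2, pi2_unit]
end PaperComma

end
end

section
/- Let V be a monoidal category with projections which is cartesian closed and whose monoidal structure (V, ⊗, I) is biclosed. If V has jointly surjective projections, then for all objects X and Y the canonical morphisms can_r : Hom(X, Y) → Homᵣ(X, Y) and can_l : Hom(X, Y) → Homₗ(X, Y) are monomorphisms. -/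
universe v u w w'

open CategoryTheory MonoidalCategory Limits

noncomputable section

namespace PaperComma

variable {V : Type u} [Category.{v} V] [MonoidalCategory V]

/-- A cartesian closed structure on `V`: for every object `X`, the functor `- ⨯ X`
admits a right adjoint `Hom(X, -)` (the cartesian internal hom). -/
structure CartClosed (V : Type u) [Category.{v} V] [HasBinaryProducts V] where
  chom : V → V ⥤ V
  adj : ∀ X : V, prod.functor.flip.obj X ⊣ chom X

namespace CartClosed

variable [HasBinaryProducts V] (cc : CartClosed V)

/-- The cartesian internal hom `Hom(X, Z)`. -/
def ch (X Z : V) : V := (cc.chom X).obj Z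

/-- Transposition under the adjunction `- ⨯ X ⊣ Hom(X, -)`. -/
def curry {W X B : V} (f : W ⨯ X ⟶ B) : W ⟶ cc.ch X B :=
  ((cc.adj X).homEquiv W B) f

/-- Inverse transposition. -/
def uncurry {W X B : V} (g : W ⟶ cc.ch X B) : W ⨯ X ⟶ B :=
  ((cc.adj X).homEquiv W B).symm g

/-- The evaluation morphism `Hom(X, Z) ⨯ X ⟶ Z`. -/
def ev (X Z : V) : cc.ch X Z ⨯ X ⟶ Z := (cc.adj X).counit.app Z

/-- The identity `I ⟶ Hom(X, X)` of the self-enrichment `V_cart` (with the terminal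
unit `I`). -/
def cid (X : V) : 𝟙_ V ⟶ cc.ch X X := cc.curry prod.snd

/-- The composition `Hom(Y, Z) ⨯ Hom(X, Y) ⟶ Hom(X, Z)` of the self-enrichment
`V_cart`. -/
def ccomp (X Y Z : V) : cc.ch Y Z ⨯ cc.ch X Y ⟶ cc.ch X Z :=
  cc.curry ((prod.associator (cc.ch Y Z) (cc.ch X Y) X).hom
    ≫ prod.map (𝟙 (cc.ch Y Z)) (cc.ev X Y) ≫ cc.ev Y Z)

/-- Contravariant action of the cartesian internal hom in its first variable. -/
def cpre {Y' Y : V} (f : Y' ⟶ Y) (Z : V) : cc.ch Y Z ⟶ cc.ch Y' Z :=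
  cc.curry (prod.map (𝟙 (cc.ch Y Z)) f ≫ cc.ev Y Z)

end CartClosed

section Canonical

variable [HasBinaryProducts V] (hI : IsTerminal (𝟙_ V))

/-- The canonical morphism `can_r : Hom(X, Y) ⟶ Homᵣ(X, Y)`, corresponding under the
adjunction `- ⊗ X ⊣ Homᵣ(X, -)` to `Hom(X, Y) ⊗ X --π--> Hom(X, Y) ⨯ X --ev--> Y`. -/
def canr (R : RightClosed V) (cc : CartClosed V) (X Y : V) : cc.ch X Y ⟶ R.hr X Y :=
  R.curry (piMap hI (cc.ch X Y) X ≫ cc.ev X Y)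

/-- The canonical morphism `can_l : Hom(X, Y) ⟶ Homₗ(X, Y)`, corresponding under the
adjunction `X ⊗ - ⊣ Homₗ(X, -)` to
`X ⊗ Hom(X, Y) --π--> X ⨯ Hom(X, Y) ≅ Hom(X, Y) ⨯ X --ev--> Y`. -/
def canl (L : LeftClosed V) (cc : CartClosed V) (X Y : V) : cc.ch X Y ⟶ L.hl X Y :=
  L.curry (piMap hI X (cc.ch X Y) ≫ (prod.braiding X (cc.ch X Y)).hom ≫ cc.ev X Y)

end Canonical

end PaperComma

namespace PaperComma

variable {V : Type u} [Category.{v} V] [MonoidalCategory V]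

theorem piMap_nat_left [HasBinaryProducts V] (hI : IsTerminal (𝟙_ V)) {W W' : V} (f : W ⟶ W')
    (X : V) : (f ▷ X) ≫ piMap hI W' X = piMap hI W X ≫ prod.map f (𝟙 X) := by
  apply Limits.prod.hom_ext
  · simp only [piMap, pi1, Category.assoc, prod.lift_fst, prod.map_fst, prod.lift_fst_assoc]
    rw [← whisker_exchange_assoc, rightUnitor_naturality]
  · simp only [piMap, pi2, Category.assoc, prod.lift_snd, prod.map_snd, prod.lift_snd_assoc,
      Category.comp_id]
    rw [← comp_whiskerRight_assoc, hI.hom_ext (f ≫ hI.from W') (hI.from W)]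

theorem piMap_nat_right [HasBinaryProducts V] (hI : IsTerminal (𝟙_ V)) {W W' : V} (f : W ⟶ W')
    (X : V) : (X ◁ f) ≫ piMap hI X W' = piMap hI X W ≫ prod.map (𝟙 X) f := by
  apply Limits.prod.hom_ext
  · simp only [piMap, pi1, Category.assoc, prod.lift_fst, prod.map_fst, prod.lift_fst_assoc,
      Category.comp_id]
    rw [← whiskerLeft_comp_assoc, hI.hom_ext (f ≫ hI.from W') (hI.from W)]
  · simp only [piMap, pi2, Category.assoc, prod.lift_snd, prod.map_snd, prod.lift_snd_assoc]
    rw [whisker_exchange_assoc, leftUnitor_naturality]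

theorem cart_ext [HasBinaryProducts V] (cc : CartClosed V) {W X Y : V} (f g : W ⟶ cc.ch X Y)
    (h : prod.map f (𝟙 X) ≫ cc.ev X Y = prod.map g (𝟙 X) ≫ cc.ev X Y) : f = g := by
  apply ((cc.adj X).homEquiv W Y).symm.injective
  erw [Adjunction.homEquiv_counit, Adjunction.homEquiv_counit]
  exact h

theorem comp_canr [HasBinaryProducts V] (hI : IsTerminal (𝟙_ V)) (R : RightClosed V)
    (cc : CartClosed V) {W X Y : V} (f : W ⟶ cc.ch X Y) :
    f ≫ canr hI R cc X Y =
      (R.adj X).homEquiv W Y (piMap hI W X ≫ prod.map f (𝟙 X) ≫ cc.ev X Y) := by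
  have h := (R.adj X).homEquiv_naturality_left f (piMap hI (cc.ch X Y) X ≫ cc.ev X Y)
  refine h.symm.trans (congrArg _ ?_)
  rw [← Category.assoc (piMap hI W X), ← piMap_nat_left, Category.assoc]
  rfl

theorem comp_canl [HasBinaryProducts V] (hI : IsTerminal (𝟙_ V)) (L : LeftClosed V)
    (cc : CartClosed V) {W X Y : V} (f : W ⟶ cc.ch X Y) :
    f ≫ canl hI L cc X Y =
      (L.adj X).homEquiv W Y (piMap hI X W ≫ (prod.braiding X W).hom ≫
        prod.map f (𝟙 X) ≫ cc.ev X Y) := by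
  have h := (L.adj X).homEquiv_naturality_left f
    (piMap hI X (cc.ch X Y) ≫ (prod.braiding X (cc.ch X Y)).hom ≫ cc.ev X Y)
  refine h.symm.trans (congrArg _ ?_)
  have e : (prod.braiding X W).hom ≫ prod.map f (𝟙 X) =
      prod.map (𝟙 X) f ≫ (prod.braiding X (cc.ch X Y)).hom := by
    apply Limits.prod.hom_ext <;> simp
  rw [reassoc_of% e, ← Category.assoc (piMap hI X W), ← piMap_nat_right, Category.assoc]
  rfl

/-- Let `V` be a monoidal category with projections which is cartesian
closed and whose monoidal structure `(V, ⊗, I)` is biclosed. If `V` has jointly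
surjective projections, then the canonical morphisms `can_r : Hom(X, Y) ⟶ Homᵣ(X, Y)`
and `can_l : Hom(X, Y) ⟶ Homₗ(X, Y)` are monomorphisms. -/
theorem canr_canl_mono [HasFiniteProducts V] (hI : IsTerminal (𝟙_ V))
    (R : RightClosed V) (L : LeftClosed V) (cc : CartClosed V)
    (hepi : ∀ X Y : V, Epi (piMap hI X Y)) (X Y : V) :
    Mono (canr hI R cc X Y) ∧ Mono (canl hI L cc X Y) := by
  refine ⟨⟨fun {W} f g h => ?_⟩, ⟨fun {W} f g h => ?_⟩⟩
  · rw [comp_canr, comp_canr] at h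
    have h' := ((R.adj X).homEquiv W Y).injective h
    have := hepi W X
    exact cart_ext cc f g ((cancel_epi (piMap hI W X)).1 h')
  · rw [comp_canl, comp_canl] at h
    have h' := ((L.adj X).homEquiv W Y).injective h
    have := hepi X W
    exact cart_ext cc f g ((cancel_epi (prod.braiding X W).hom).1
      ((cancel_epi (piMap hI X W)).1 h'))

end PaperComma

end
end

section
/- Let V be a monoidal category with projections which is cartesian closed and whose monoidal structure (V, ⊗, I) is biclosed. For objects X, Y, Z of V, define φ : X ⊗ (Y × Z) → (X ⊗ Y) × Z as the morphism whose first component is X ⊗ p₁ : X ⊗ (Y × Z) → X ⊗ Y and whose second component is p₂ ∘ π₂ : X ⊗ (Y × Z) → Y × Z → Z, and define λ : Homₗ(X, Hom(Y, Z)) → Hom(Y, Homₗ(X, Z)) as the morphism obtained by transposing twice (first under X ⊗ − ⊣ Homₗ(X, −), then under − × Y ⊣ Hom(Y, −)) the composite X ⊗ (Homₗ(X, Hom(Y, Z)) × Y) --φ--> (X ⊗ Homₗ(X, Hom(Y, Z))) × Y --ev × Y--> Hom(Y, Z) × Y --ev--> Z. Then λ is natural in X, Y and Z, and the following square commutes: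 the composite of λ with the morphism Hom(Y, Homₗ(X, Z)) → Homᵣ(Y, Homₗ(X, Z)) induced by can_r equals the composite of Homₗ(X, can_r) : Homₗ(X, Hom(Y, Z)) → Homₗ(X, Homᵣ(Y, Z)) with the canonical isomorphism Homₗ(X, Homᵣ(Y, Z)) ≅ Homᵣ(Y, Homₗ(X, Z)). -/
universe v u w w'

open CategoryTheory MonoidalCategory Limits

noncomputable section

namespace PaperComma

variable {V : Type u} [Category.{v} V] [MonoidalCategory V]

section Lam

variable [HasBinaryProducts V] (hI : IsTerminal (𝟙_ V))

/-- The canonical morphism `φ : X ⊗ (Y ⨯ Z) ⟶ (X ⊗ Y) ⨯ Z`, with first component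
`X ◁ p₁` and second component `p₂ ∘ π₂`. -/
def phi (X Y Z : V) : X ⊗ (Y ⨯ Z) ⟶ (X ⊗ Y) ⨯ Z :=
  prod.lift (X ◁ prod.fst) (pi2 hI X (Y ⨯ Z) ≫ prod.snd)

/-- The canonical morphism `λ : Homₗ(X, Hom(Y, Z)) ⟶ Hom(Y, Homₗ(X, Z))`, obtained by
transposing twice the composite
`X ⊗ (Homₗ(X, Hom(Y, Z)) ⨯ Y) --φ--> (X ⊗ Homₗ(X, Hom(Y, Z))) ⨯ Y --ev ⨯ Y--> Hom(Y, Z) ⨯ Y --ev--> Z`. -/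
def lam (L : LeftClosed V) (cc : CartClosed V) (X Y Z : V) :
    L.hl X (cc.ch Y Z) ⟶ cc.ch Y (L.hl X Z) :=
  cc.curry (L.curry
    (phi hI X (L.hl X (cc.ch Y Z)) Y
      ≫ prod.map (L.ev X (cc.ch Y Z)) (𝟙 Y) ≫ cc.ev Y Z))

/-- The canonical isomorphism-defining morphism
`Homₗ(X, Homᵣ(Y, Z)) ⟶ Homᵣ(Y, Homₗ(X, Z))`, corresponding to
`(X ⊗ Homₗ(X, Homᵣ(Y, Z))) ⊗ Y --ev ⊗ Y--> Homᵣ(Y, Z) ⊗ Y --ev--> Z`. -/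
def switch (R : RightClosed V) (L : LeftClosed V) (X Y Z : V) :
    L.hl X (R.hr Y Z) ⟶ R.hr Y (L.hl X Z) :=
  R.curry (L.curry
    ((α_ X (L.hl X (R.hr Y Z)) Y).inv ≫ (L.ev X (R.hr Y Z) ▷ Y) ≫ R.ev Y Z))

end Lam

end PaperComma

namespace PaperComma

variable {V : Type u} [Category.{v} V] [MonoidalCategory V]

section Helpers

set_option linter.unusedSectionVars false

variable [HasBinaryProducts V] (hI : IsTerminal (𝟙_ V))
  (R : RightClosed V) (L : LeftClosed V) (cc : CartClosed V)

def lmap (X : V) {A B : V} (h : A ⟶ B) : L.hl X A ⟶ L.hl X B := (L.homl X).map h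

def cmap (X : V) {A B : V} (h : A ⟶ B) : cc.ch X A ⟶ cc.ch X B := (cc.chom X).map h

lemma r_uncurry {W Y Z : V} (a : W ⟶ R.hr Y Z) : R.uncurry a = a ▷ Y ≫ R.ev Y Z :=
  (R.adj Y).homEquiv_counit _ _ _

lemma l_uncurry {W X Z : V} (a : W ⟶ L.hl X Z) : L.uncurry a = X ◁ a ≫ L.ev X Z :=
  (L.adj X).homEquiv_counit _ _ _

lemma c_uncurry {W Y Z : V} (a : W ⟶ cc.ch Y Z) :
    cc.uncurry a = prod.map a (𝟙 Y) ≫ cc.ev Y Z :=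
  (cc.adj Y).homEquiv_counit _ _ _

lemma r_beta {W Y Z : V} (f : W ⊗ Y ⟶ Z) : R.curry f ▷ Y ≫ R.ev Y Z = f := by
  rw [← r_uncurry]; exact ((R.adj Y).homEquiv W Z).symm_apply_apply f

lemma l_beta {W X Z : V} (f : X ⊗ W ⟶ Z) : X ◁ L.curry f ≫ L.ev X Z = f := by
  rw [← l_uncurry]; exact ((L.adj X).homEquiv W Z).symm_apply_apply f

lemma c_beta {W Y Z : V} (f : W ⨯ Y ⟶ Z) :
    prod.map (cc.curry f) (𝟙 Y) ≫ cc.ev Y Z = f := by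
  rw [← c_uncurry]; exact ((cc.adj Y).homEquiv W Z).symm_apply_apply f

lemma r_ext {W Y Z : V} {a b : W ⟶ R.hr Y Z}
    (h : a ▷ Y ≫ R.ev Y Z = b ▷ Y ≫ R.ev Y Z) : a = b := by
  rw [← r_uncurry, ← r_uncurry] at h; exact ((R.adj Y).homEquiv W Z).symm.injective h

lemma l_ext {W X Z : V} {a b : W ⟶ L.hl X Z}
    (h : X ◁ a ≫ L.ev X Z = X ◁ b ≫ L.ev X Z) : a = b := by
  rw [← l_uncurry, ← l_uncurry] at h; exact ((L.adj X).homEquiv W Z).symm.injective h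

lemma c_ext {W Y Z : V} {a b : W ⟶ cc.ch Y Z}
    (h : prod.map a (𝟙 Y) ≫ cc.ev Y Z = prod.map b (𝟙 Y) ≫ cc.ev Y Z) : a = b := by
  rw [← c_uncurry, ← c_uncurry] at h; exact ((cc.adj Y).homEquiv W Z).symm.injective h

lemma lmap_ev (X : V) {A B : V} (h : A ⟶ B) :
    X ◁ lmap L X h ≫ L.ev X B = L.ev X A ≫ h :=
  (L.adj X).counit.naturality h

lemma cmap_ev (Y : V) {A B : V} (h : A ⟶ B) :
    prod.map (cmap cc Y h) (𝟙 Y) ≫ cc.ev Y B = cc.ev Y A ≫ h :=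
  (cc.adj Y).counit.naturality h

lemma pi1_nat {A B C D : V} (f : A ⟶ B) (g : C ⟶ D) :
    (f ▷ C ≫ B ◁ g) ≫ pi1 hI B D = pi1 hI A C ≫ f := by
  have : g ≫ hI.from D = hI.from C := hI.hom_ext _ _
  simp only [pi1, Category.assoc]
  rw [← whiskerLeft_comp_assoc, this, ← whisker_exchange_assoc, rightUnitor_naturality]

lemma pi2_nat {A B C D : V} (f : A ⟶ B) (g : C ⟶ D) :
    (f ▷ C ≫ B ◁ g) ≫ pi2 hI B D = pi2 hI A C ≫ g := by
  have : f ≫ hI.from B = hI.from A := hI.hom_ext _ _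
  simp only [pi2, Category.assoc]
  rw [whisker_exchange_assoc, ← comp_whiskerRight_assoc, this, leftUnitor_naturality]

lemma pi2_natl (X : V) {C D : V} (g : C ⟶ D) :
    X ◁ g ≫ pi2 hI X D = pi2 hI X C ≫ g := by
  simpa using pi2_nat hI (𝟙 X) g

lemma pi2_natr {A B : V} (f : A ⟶ B) (C : V) :
    f ▷ C ≫ pi2 hI B C = pi2 hI A C := by
  simpa using pi2_nat hI f (𝟙 C)

lemma pi1_natr {A B : V} (f : A ⟶ B) (C : V) :
    f ▷ C ≫ pi1 hI B C = pi1 hI A C ≫ f := by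
  simpa using pi1_nat hI f (𝟙 C)

lemma piMap_natr {A B : V} (f : A ⟶ B) (C : V) :
    f ▷ C ≫ piMap hI B C = piMap hI A C ≫ prod.map f (𝟙 C) := by
  ext <;> simp [piMap, pi1_natr, pi2_natr]

lemma phi_nat (X : V) {A B C D : V} (f : A ⟶ B) (g : C ⟶ D) :
    X ◁ prod.map f g ≫ phi hI X B D = phi hI X A C ≫ prod.map (X ◁ f) g := by
  ext
  · simp only [phi, Category.assoc, prod.lift_fst, prod.map_fst, prod.lift_fst_assoc,
      ← whiskerLeft_comp]
  · simp only [phi, Category.assoc, prod.lift_snd, prod.map_snd, prod.lift_snd_assoc]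
    rw [← Category.assoc, pi2_natl]; simp

lemma phi_natX {X X' : V} (g : X' ⟶ X) (A B : V) :
    g ▷ (A ⨯ B) ≫ phi hI X A B = phi hI X' A B ≫ prod.map (g ▷ A) (𝟙 B) := by
  ext
  · simp only [phi, Category.assoc, prod.lift_fst, prod.map_fst, prod.lift_fst_assoc,
      whisker_exchange]
  · simp only [phi, Category.assoc, prod.lift_snd, prod.map_snd, prod.lift_snd_assoc]
    rw [← Category.assoc, pi2_natr]; simp

lemma pi2_assoc (X W Y : V) :
    pi2 hI X (W ⊗ Y) ≫ pi2 hI W Y = (α_ X W Y).inv ≫ pi2 hI (X ⊗ W) Y := by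
  have h := pi2_natr hI (pi2 hI X W) Y
  rw [← h]
  simp [pi2]

lemma piMap_phi (X W Y : V) :
    X ◁ piMap hI W Y ≫ phi hI X W Y = (α_ X W Y).inv ≫ piMap hI (X ⊗ W) Y := by
  ext
  · simp only [phi, piMap, Category.assoc, prod.lift_fst, ← whiskerLeft_comp]
    simp [pi1]
  · simp only [phi, Category.assoc, prod.lift_snd]
    rw [← Category.assoc, pi2_natl]
    simp only [piMap, Category.assoc, prod.lift_snd, pi2_assoc]

lemma lam_ext {W X Y Z : V} {a b : W ⟶ cc.ch Y (L.hl X Z)}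
    (h : X ◁ (prod.map a (𝟙 Y) ≫ cc.ev _ _) ≫ L.ev X Z =
      X ◁ (prod.map b (𝟙 Y) ≫ cc.ev _ _) ≫ L.ev X Z) : a = b :=
  c_ext cc (l_ext L h)

lemma lam_beta (X Y Z : V) :
    prod.map (lam hI L cc X Y Z) (𝟙 Y) ≫ cc.ev _ _ = L.curry
    (phi hI X (L.hl X (cc.ch Y Z)) Y
      ≫ prod.map (L.ev X (cc.ch Y Z)) (𝟙 Y) ≫ cc.ev Y Z) := c_beta _ _

/-- Double transpose of a composite with `lam`. -/
lemma comp_lam {W X Y Z : V} (a : W ⟶ L.hl X (cc.ch Y Z)) :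
    X ◁ (prod.map (a ≫ lam hI L cc X Y Z) (𝟙 Y) ≫ cc.ev _ _) ≫ L.ev X Z =
      phi hI X W Y ≫ prod.map (X ◁ a ≫ L.ev _ _) (𝟙 Y) ≫ cc.ev Y Z := by
  have h : prod.map (a ≫ lam hI L cc X Y Z) (𝟙 Y) =
    prod.map a (𝟙 Y) ≫ prod.map (lam hI L cc X Y Z) (𝟙 Y) := by simp
  have h2 : prod.map (X ◁ a ≫ L.ev X (cc.ch Y Z)) (𝟙 Y) =
    prod.map (X ◁ a) (𝟙 Y) ≫ prod.map (L.ev _ _) (𝟙 Y) := by simp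
  rw [h, h2, Category.assoc, lam_beta, whiskerLeft_comp, Category.assoc, l_beta,
    ← Category.assoc, phi_nat, Category.assoc, Category.assoc]

lemma lam_tr (X Y Z : V) :
    X ◁ (prod.map (lam hI L cc X Y Z) (𝟙 Y) ≫ cc.ev _ _) ≫ L.ev X Z =
      phi hI X _ Y ≫ prod.map (L.ev _ _) (𝟙 Y) ≫ cc.ev Y Z := by
  rw [lam_beta, l_beta]

lemma pm_comp {A B C Y : V} (f : A ⟶ B) (g : B ⟶ C) :
    prod.map (f ≫ g) (𝟙 Y) = prod.map f (𝟙 Y) ≫ prod.map g (𝟙 Y) := by simp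

lemma natZ (X Y Z Z' : V) (h : Z ⟶ Z') :
    lmap L X (cmap cc Y h) ≫ lam hI L cc X Y Z'
      = lam hI L cc X Y Z ≫ cmap cc Y (lmap L X h) := by
  apply lam_ext
  rw [comp_lam, lmap_ev, pm_comp, pm_comp, Category.assoc, Category.assoc, cmap_ev, cmap_ev,
    ← Category.assoc (prod.map _ _) (cc.ev _ _) (lmap _ _ _), whiskerLeft_comp, Category.assoc, lmap_ev,
    ← Category.assoc (X ◁ _), lam_tr]
  simp only [Category.assoc]

lemma natY (X Y Y' Z : V) (f : Y' ⟶ Y) :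
    lmap L X (cc.cpre f Z) ≫ lam hI L cc X Y' Z
      = lam hI L cc X Y Z ≫ cc.cpre f (L.hl X Z) := by
  apply lam_ext
  have e : prod.map (lam hI L cc X Y Z) (𝟙 Y') ≫ prod.map (𝟙 _) f =
    prod.map (𝟙 _) f ≫ prod.map (lam hI L cc X Y Z) (𝟙 Y) := by simp
  have e2 : prod.map (L.ev X (cc.ch Y Z)) (𝟙 Y') ≫ prod.map (𝟙 _) f =
    prod.map (𝟙 _) f ≫ prod.map (L.ev X (cc.ch Y Z)) (𝟙 Y) := by simp
  rw [comp_lam, lmap_ev, pm_comp, pm_comp, Category.assoc, Category.assoc, CartClosed.cpre,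
    CartClosed.cpre, c_beta, c_beta, ← Category.assoc (prod.map (lam _ _ _ _ _ _) _) (prod.map _ _), e,
    ← Category.assoc (prod.map (L.ev _ _) _) (prod.map _ _), e2, Category.assoc, Category.assoc,
    whiskerLeft_comp, Category.assoc, lam_tr, ← Category.assoc (X ◁ _), phi_nat]
  simp

lemma natX (X X' Y Z : V) (g : X' ⟶ X) :
    L.pre g (cc.ch Y Z) ≫ lam hI L cc X' Y Z
      = lam hI L cc X Y Z ≫ cmap cc Y (L.pre g Z) := by
  apply lam_ext
  rw [comp_lam, LeftClosed.pre, l_beta, pm_comp, pm_comp, Category.assoc, Category.assoc, cmap_ev,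
    ← Category.assoc (prod.map _ _) (cc.ev _ _), whiskerLeft_comp, Category.assoc,
    LeftClosed.pre, l_beta, whisker_exchange_assoc, lam_tr,
    ← Category.assoc (g ▷ _), phi_natX, Category.assoc]

lemma square (X Y Z : V) :
    lam hI L cc X Y Z ≫ canr hI R cc Y (L.hl X Z)
      = lmap L X (canr hI R cc Y Z) ≫ switch R L X Y Z := by
  apply r_ext
  apply l_ext
  rw [comp_whiskerRight, comp_whiskerRight, Category.assoc, Category.assoc, canr, r_beta,
    switch, r_beta, ← Category.assoc (_ ▷ _) (piMap _ _ _), piMap_natr, Category.assoc,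
    whiskerLeft_comp, Category.assoc, lam_tr, ← Category.assoc (X ◁ _), piMap_phi,
    whiskerLeft_comp, Category.assoc, Category.assoc, l_beta, associator_inv_naturality_middle_assoc,
    ← comp_whiskerRight_assoc, lmap_ev, comp_whiskerRight, Category.assoc, canr, r_beta,
    ← Category.assoc (_ ▷ _) (piMap _ _ _), piMap_natr, Category.assoc]

end Helpers

/-- Let `V` be a monoidal category with projections, cartesian closed,
with biclosed monoidal structure. The canonical morphism
`λ : Homₗ(X, Hom(Y, Z)) ⟶ Hom(Y, Homₗ(X, Z))` is natural in `X`, `Y` and `Z`, and the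
square relating it to `can_r` and the canonical isomorphism
`Homₗ(X, Homᵣ(Y, Z)) ≅ Homᵣ(Y, Homₗ(X, Z))` commutes. -/
theorem lam_natural_and_square [HasFiniteProducts V] (hI : IsTerminal (𝟙_ V))
    (R : RightClosed V) (L : LeftClosed V) (cc : CartClosed V) :
    -- naturality in `Z` (covariant)
    (∀ (X Y Z Z' : V) (h : Z ⟶ Z'),
      (L.homl X).map ((cc.chom Y).map h) ≫ lam hI L cc X Y Z'
        = lam hI L cc X Y Z ≫ (cc.chom Y).map ((L.homl X).map h)) ∧
    -- naturality in `Y` (contravariant)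
    (∀ (X Y Y' Z : V) (f : Y' ⟶ Y),
      (L.homl X).map (cc.cpre f Z) ≫ lam hI L cc X Y' Z
        = lam hI L cc X Y Z ≫ cc.cpre f (L.hl X Z)) ∧
    -- naturality in `X` (contravariant)
    (∀ (X X' Y Z : V) (g : X' ⟶ X),
      L.pre g (cc.ch Y Z) ≫ lam hI L cc X' Y Z
        = lam hI L cc X Y Z ≫ (cc.chom Y).map (L.pre g Z)) ∧
    -- the commutative square
    (∀ X Y Z : V,
      lam hI L cc X Y Z ≫ canr hI R cc Y (L.hl X Z)
        = (L.homl X).map (canr hI R cc Y Z) ≫ switch R L X Y Z) := by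
  exact ⟨natZ hI L cc, natY hI L cc, natX hI L cc, square hI R L cc⟩

end PaperComma

end
end
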